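/- arXiv:2408.14455 — 2 statements merged into one kernel-verified Lean document; each statement's English description precedes it below -/
import Mathlib

section
/- Let G be a labeled graph on n vertices with m edges such that G is equal to its flipped labeled graph G' (i.e., uv is an edge of G if and only if (n+1−u)(n+1−v) is an edge of G). Then the chromatic quasisymmetric function of G is palindromic: N_G(α,k) = N_G(α,m−k) for every composition α of n and every 0 ≤ k ≤ m. -/
/-- A proper coloring of a labeled graph on vertex set `Fin n` (vertex `v` represents
label `v+1`), with colors in `{1,2,...}`. -/
def properColoring {n : ℕ} (G : SimpleGraph (Fin n)) (c : Fin n → ℕ) : Prop :=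
  ∀ u v : Fin n, G.Adj u v → c u ≠ c v

/-- The ascent number of a coloring: the number of edges `uv` with `u < v` and `c u < c v`. -/
noncomputable def ascNum {n : ℕ} (G : SimpleGraph (Fin n)) (c : Fin n → ℕ) : ℕ :=
  Nat.card {p : Fin n × Fin n // p.1 < p.2 ∧ G.Adj p.1 p.2 ∧ c p.1 < c p.2}

/-- The descent number of a coloring: the number of edges `uv` with `u < v` and `c u > c v`. -/
noncomputable def desNum {n : ℕ} (G : SimpleGraph (Fin n)) (c : Fin n → ℕ) : ℕ :=
  Nat.card {p : Fin n × Fin n // p.1 < p.2 ∧ G.Adj p.1 p.2 ∧ c p.2 < c p.1}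

/-- The coloring `c` uses exactly the colors `1,…,L.length`, color `a` being used
exactly `L.get (a-1)` times. -/
def usesPalette {n : ℕ} (L : List ℕ) (c : Fin n → ℕ) : Prop :=
  (∀ v : Fin n, 1 ≤ c v ∧ c v ≤ L.length) ∧
  ∀ i : Fin L.length, Nat.card {v : Fin n // c v = (i : ℕ) + 1} = L.get i

/-- `NG G L k` is the number of proper colorings of `G` with ascent number `k`
and palette `L`. -/
noncomputable def NG {n : ℕ} (G : SimpleGraph (Fin n)) (L : List ℕ) (k : ℕ) : ℕ :=
  Nat.card {c : Fin n → ℕ // properColoring G c ∧ usesPalette L c ∧ ascNum G c = k}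

/-- `L` is a composition of `n`: a list of positive integers summing to `n`. -/
def IsComposition (n : ℕ) (L : List ℕ) : Prop :=
  (∀ a ∈ L, 0 < a) ∧ L.sum = n

/-- The chromatic quasisymmetric function of `G` is symmetric. -/
def cqfSymmetric {n : ℕ} (G : SimpleGraph (Fin n)) : Prop :=
  ∀ L M : List ℕ, IsComposition n L → IsComposition n M → List.Perm L M →
    ∀ k : ℕ, NG G L k = NG G M k

/-- The number of edges of `G`. -/
noncomputable def edgeCount {n : ℕ} (G : SimpleGraph (Fin n)) : ℕ := Nat.card G.edgeSet

/-- The chromatic quasisymmetric function of `G` is palindromic. -/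
def cqfPalindromic {n : ℕ} (G : SimpleGraph (Fin n)) : Prop :=
  ∀ L : List ℕ, IsComposition n L →
    ∀ k : ℕ, k ≤ edgeCount G → NG G L k = NG G L (edgeCount G - k)

/-- The labeled path `P_w` of a permutation `w` of `Fin n`: edges `{w i, w (i+1)}`. -/
def pathGraph {n : ℕ} (w : Equiv.Perm (Fin n)) : SimpleGraph (Fin n) :=
  SimpleGraph.fromRel (fun u v => ∃ i : ℕ, ∃ h : i + 1 < n,
    u = w ⟨i, by omega⟩ ∧ v = w ⟨i + 1, h⟩)

/-- The flipped labeled graph: `uv` is an edge iff `(n+1-u)(n+1-v)` is an edge of `G`. -/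
def flipGraph {n : ℕ} (G : SimpleGraph (Fin n)) : SimpleGraph (Fin n) :=
  SimpleGraph.comap Fin.rev G

/-- The ascent-descent pattern of `w`, where `true` records an ascent (`a`) and
`false` records a descent (`d`). -/
def adPattern {n : ℕ} (w : Equiv.Perm (Fin n)) : List Bool :=
  List.ofFn (fun i : Fin (n - 1) =>
    decide (w ⟨(i : ℕ), by have := i.isLt; omega⟩ < w ⟨(i : ℕ) + 1, by have := i.isLt; omega⟩))

/-- The ribbon word `a^{α₁-1} d a^{α₂-1} d ⋯ d a^{α_ℓ-1}` of a composition. -/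
def ribbonWord : List ℕ → List Bool
  | [] => []
  | [a] => List.replicate (a - 1) true
  | a :: b :: rest => List.replicate (a - 1) true ++ false :: ribbonWord (b :: rest)

/-- Position `i` is a local minimum of `w`. -/
def LocalMinAt {n : ℕ} (w : Equiv.Perm (Fin n)) (i : Fin n) : Prop :=
  (∀ _ : 0 < (i : ℕ), w i < w ⟨(i : ℕ) - 1, by have := i.isLt; omega⟩) ∧
  (∀ h : (i : ℕ) + 1 < n, w i < w ⟨(i : ℕ) + 1, h⟩)

/-- Position `i` is a local maximum of `w`. -/
def LocalMaxAt {n : ℕ} (w : Equiv.Perm (Fin n)) (i : Fin n) : Prop :=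
  (∀ _ : 0 < (i : ℕ), w ⟨(i : ℕ) - 1, by have := i.isLt; omega⟩ < w i) ∧
  (∀ h : (i : ℕ) + 1 < n, w ⟨(i : ℕ) + 1, h⟩ < w i)

/-- The labeled star `K_{1,n-1}` with central vertex `j`. -/
def starGraph (n : ℕ) (j : Fin n) : SimpleGraph (Fin n) :=
  SimpleGraph.fromRel (fun u v => u = j ∧ v ≠ j)

/-- Reversing the vertex order turns ascents into descents. -/
theorem ascNum_comp_rev {n : ℕ} {G : SimpleGraph (Fin n)} (hG : flipGraph G = G)
    (c : Fin n → ℕ) : ascNum G (c ∘ Fin.rev) = desNum G c := by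
  have hadj : ∀ u v, G.Adj (Fin.rev u) (Fin.rev v) ↔ G.Adj u v := fun u v => by
    conv_rhs => rw [← hG]
    rfl
  refine Nat.card_congr (Equiv.subtypeEquiv
    ((Equiv.prodComm _ _).trans (Fin.revPerm.prodCongr Fin.revPerm)) ?_)
  rintro ⟨u, v⟩
  simp [hadj, G.adj_comm v u]

/-- Every edge of a properly colored graph is either an ascent or a descent. -/
theorem ascNum_add_desNum {n : ℕ} {G : SimpleGraph (Fin n)} {c : Fin n → ℕ}
    (hc : properColoring G c) : ascNum G c + desNum G c = edgeCount G := by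
  classical
  have hedges : Nat.card {p : Fin n × Fin n // p.1 < p.2 ∧ G.Adj p.1 p.2} = edgeCount G := by
    refine Nat.card_eq_of_bijective
      (fun p => (⟨s(p.1.1, p.1.2), p.2.2⟩ : G.edgeSet)) ⟨?_, ?_⟩
    · rintro ⟨⟨a, b⟩, hab, _⟩ ⟨⟨u, v⟩, huv, _⟩ h
      replace h := Sym2.eq_iff.1 (congrArg Subtype.val h)
      dsimp only at hab huv
      rcases h with ⟨rfl, rfl⟩ | ⟨rfl, rfl⟩
      · rfl
      · exact absurd hab huv.asymm
    · rintro ⟨e, he⟩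
      induction e with
      | h u v =>
        rcases lt_or_gt_of_ne (G.ne_of_adj he) with h | h
        · exact ⟨⟨(u, v), h, he⟩, rfl⟩
        · exact ⟨⟨(v, u), h, G.adj_symm he⟩, Subtype.ext Sym2.eq_swap⟩
  rw [← hedges, ascNum, desNum]
  simp only [Nat.card_eq_fintype_card, Fintype.card_subtype]
  rw [← Finset.card_union_of_disjoint]
  · congr 1
    ext ⟨u, v⟩
    have := hc u v
    simp only [Finset.mem_union, Finset.mem_filter, Finset.mem_univ, true_and]
    grind
  · rw [Finset.disjoint_filter]
    intro p _ h h'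
    exact h.2.2.asymm h'.2.2

/-- Reversing the vertex order preserves the palette of a coloring. -/
theorem usesPalette_comp_rev {n : ℕ} {L : List ℕ} {c : Fin n → ℕ} (hc : usesPalette L c) :
    usesPalette L (c ∘ Fin.rev) :=
  ⟨fun v => hc.1 v.rev, fun i => (Nat.card_congr
    (Equiv.subtypeEquiv Fin.revPerm fun _ => Iff.rfl)).trans (hc.2 i)⟩

/-- Reversing the vertex order preserves properness when the graph equals its flip. -/
theorem properColoring_comp_rev {n : ℕ} {G : SimpleGraph (Fin n)} (hG : flipGraph G = G)
    {c : Fin n → ℕ} (hc : properColoring G c) : properColoring G (c ∘ Fin.rev) := by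
  intro u v huv
  rw [← hG] at huv
  exact hc _ _ huv

/-- If a labeled graph equals its flip, then its CQF is palindromic. -/
theorem stmt2 (n : ℕ) (G : SimpleGraph (Fin n)) (hG : flipGraph G = G) :
    cqfPalindromic G := by
  intro L _ k hk
  have hrev : ∀ c : Fin n → ℕ, (c ∘ Fin.rev) ∘ Fin.rev = c := fun c => by
    ext v
    simp
  have hstep : ∀ {c : Fin n → ℕ} {j : ℕ},
      properColoring G c ∧ usesPalette L c ∧ ascNum G c = j →
      properColoring G (c ∘ Fin.rev) ∧ usesPalette L (c ∘ Fin.rev) ∧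
        ascNum G (c ∘ Fin.rev) = edgeCount G - j := by
    rintro c j ⟨hc, hL, rfl⟩
    refine ⟨properColoring_comp_rev hG hc, usesPalette_comp_rev hL, ?_⟩
    rw [ascNum_comp_rev hG, ← ascNum_add_desNum hc, Nat.add_sub_cancel_left]
  refine Nat.card_congr
    ⟨fun c => ⟨c.1 ∘ Fin.rev, hstep c.2⟩, fun c => ⟨c.1 ∘ Fin.rev, ?_⟩,
      fun c => Subtype.ext (hrev c.1), fun c => Subtype.ext (hrev c.1)⟩
  simpa only [Nat.sub_sub_self hk] using hstep c.2
end

section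
/- Let w = (w_1,…,w_n) be a permutation of {1,…,n} whose ribbon composition (α_1,…,α_k) satisfies k ≥ 2 and α_i ≥ 2 for all 1 ≤ i ≤ k. Then the chromatic quasisymmetric function of the labeled path P_w is not symmetric. -/
section RibbonWord

theorem ribbonWord_getElem?_zero {α : List ℕ} (hne : α ≠ []) (h2 : ∀ a ∈ α, 2 ≤ a) :
    (ribbonWord α)[0]? = some true := by
  match α, hne, h2 with
  | [a], _, h2 =>
    have := h2 a (by simp)
    simp only [ribbonWord, List.getElem?_replicate]
    rw [if_pos (by omega)]
  | a :: b :: l, _, h2 =>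
    have := h2 a (by simp)
    simp only [ribbonWord]
    rw [List.getElem?_append_left (by simp; omega), List.getElem?_replicate, if_pos (by omega)]

/-- If all parts are at least `2`, every descent of the ribbon word lies between two ascents. -/
theorem ribbonWord_isolated_descents (α : List ℕ) (h2 : ∀ a ∈ α, 2 ≤ a) (i : ℕ)
    (hi : (ribbonWord α)[i]? = some false) :
    1 ≤ i ∧ (ribbonWord α)[i - 1]? = some true ∧ (ribbonWord α)[i + 1]? = some true := by
  match α, h2 with
  | [], _ => simp [ribbonWord] at hi
  | [a], _ =>
    simp only [ribbonWord, List.getElem?_replicate] at hi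
    simp at hi
  | a :: b :: l, h2 =>
    have ha := h2 a (by simp)
    have h2' : ∀ x ∈ b :: l, 2 ≤ x := fun x hx => h2 x (List.mem_cons_of_mem _ hx)
    have h0 := ribbonWord_getElem?_zero (by simp) h2'
    simp only [ribbonWord] at hi ⊢
    rcases lt_trichotomy i (a - 1) with h | h | h
    · rw [List.getElem?_append_left (by simpa using h), List.getElem?_replicate, if_pos h] at hi
      simp at hi
    · subst h
      refine ⟨by omega, ?_, ?_⟩
      · rw [List.getElem?_append_left (by simp; omega), List.getElem?_replicate,
          if_pos (by omega)]
      · rw [List.getElem?_append_right (by simp)]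
        simpa using h0
    · obtain ⟨j, rfl⟩ : ∃ j, i = a - 1 + (j + 1) := ⟨i - (a - 1) - 1, by omega⟩
      rw [List.getElem?_append_right (by simp)] at hi
      simp only [List.length_replicate, Nat.add_sub_cancel_left, List.getElem?_cons_succ] at hi
      obtain ⟨hj, hp, hn⟩ := ribbonWord_isolated_descents (b :: l) h2' j hi
      obtain ⟨j, rfl⟩ : ∃ t, j = t + 1 := ⟨j - 1, by omega⟩
      refine ⟨by omega, ?_, ?_⟩
      · rw [show a - 1 + (j + 1 + 1) - 1 = a - 1 + (j + 1) by omega,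
          List.getElem?_append_right (by simp)]
        simpa using hp
      · rw [add_assoc, List.getElem?_append_right (by simp)]
        simpa using hn

theorem false_mem_ribbonWord {α : List ℕ} (hlen : 2 ≤ α.length) : false ∈ ribbonWord α := by
  match α, hlen with
  | a :: b :: l, _ => simp [ribbonWord]

end RibbonWord

section SpikeList

/-- The composition with `l + 1` parts whose part of index `m` is `k`, all others being `1`. -/
def spikeList (l k : ℕ) (m : Fin (l + 1)) : List ℕ :=
  List.ofFn fun i : Fin (l + 1) => if i = m then k else 1

theorem spikeList_perm (l k : ℕ) (m m' : Fin (l + 1)) :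
    List.Perm (spikeList l k m) (spikeList l k m') := by
  have h := Equiv.Perm.ofFn_comp_perm (Equiv.swap m m')
    (fun i : Fin (l + 1) => if i = m' then k else 1)
  refine (List.Perm.of_eq ?_).trans h
  refine congrArg List.ofFn (funext fun i => ?_)
  simp only [Function.comp]
  simp only [Equiv.swap_apply_eq_iff, Equiv.swap_apply_right]

theorem isComposition_spikeList {n l k : ℕ} (hk : 0 < k) (hn : n = k + l) (m : Fin (l + 1)) :
    IsComposition n (spikeList l k m) := by
  constructor
  · intro a ha
    obtain ⟨i, rfl⟩ := (List.mem_ofFn' _ _).1 ha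
    dsimp only
    split_ifs <;> omega
  · rw [spikeList, List.sum_ofFn, Finset.sum_ite]
    simp [Finset.filter_eq', Finset.filter_ne', hn]

theorem usesPalette_spikeList {n l k : ℕ} {m : Fin (l + 1)} {f : Fin n → ℕ} :
    usesPalette (spikeList l k m) f ↔ (∀ v, 1 ≤ f v ∧ f v ≤ l + 1) ∧
      ∀ i : Fin (l + 1), Nat.card {v // f v = (i : ℕ) + 1} = if i = m then k else 1 := by
  have hl : (spikeList l k m).length = l + 1 := by simp [spikeList]
  have hget : ∀ i, (spikeList l k m).get i = if Fin.cast hl i = m then k else 1 := fun i =>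
    List.get_ofFn _ _
  refine and_congr (by rw [hl]) ⟨fun h i => ?_, fun h i => ?_⟩
  · have := h (Fin.cast hl.symm i)
    rw [hget] at this
    exact this
  · rw [hget]
    exact h (Fin.cast hl i)

end SpikeList

section Zigzag

/-- `f` is strictly decreasing at the steps in `D` and strictly increasing at the other steps. -/
def FollowsPattern {n : ℕ} (D : ℕ → Prop) (f : Fin n → ℕ) : Prop :=
  ∀ (i : ℕ) (h : i + 1 < n), (D i → f ⟨i + 1, h⟩ < f ⟨i, by omega⟩) ∧
    (¬ D i → f ⟨i, by omega⟩ < f ⟨i + 1, h⟩)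

/-- Position `i` is the first of a maximal increasing run of the pattern with descents `D`. -/
def RunStart (D : ℕ → Prop) (i : ℕ) : Prop := i = 0 ∨ D (i - 1)

theorem runStart_succ {D : ℕ → Prop} {i : ℕ} : RunStart D (i + 1) ↔ D i := by
  simp [RunStart]

open Classical in
/-- Number of positions before `i` that do not start a run. -/
noncomputable def nonstarts (D : ℕ → Prop) (i : ℕ) : ℕ := Nat.count (fun j => ¬ RunStart D j) i

open Classical in
/-- Number of runs starting before position `i`. -/
noncomputable def starts (D : ℕ → Prop) (i : ℕ) : ℕ := Nat.count (RunStart D) i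

variable {n : ℕ} {D : ℕ → Prop}

theorem starts_add_nonstarts (D : ℕ → Prop) (i : ℕ) : starts D i + nonstarts D i = i := by
  classical
  induction i with
  | zero => simp [starts, nonstarts]
  | succ i ih =>
    simp only [starts, nonstarts, Nat.count_succ] at ih ⊢
    by_cases h : RunStart D i <;> simp [h] <;> omega

theorem starts_mono (D : ℕ → Prop) : Monotone (starts D) := by
  classical
  exact Nat.count_monotone _

theorem starts_one (D : ℕ → Prop) : starts D 1 = 1 := by
  classical
  simp [starts, Nat.count_succ, RunStart]

theorem starts_succ_of {i : ℕ} (h : RunStart D i) : starts D (i + 1) = starts D i + 1 := by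
  classical
  simp [starts, Nat.count_succ, h]

theorem starts_succ_of_not {i : ℕ} (h : ¬ RunStart D i) : starts D (i + 1) = starts D i := by
  classical
  simp [starts, Nat.count_succ, h]

theorem FollowsPattern.lt_of_same_run {f : Fin n → ℕ} (hf : FollowsPattern D f) {i j : Fin n}
    (hij : i < j) (h : starts D (i + 1) = starts D (j + 1)) : f i < f j := by
  obtain ⟨i, hi⟩ := i
  obtain ⟨j, hj⟩ := j
  simp only [Fin.mk_lt_mk] at hij h
  induction j with
  | zero => omega
  | succ j ih =>
    have h1 := starts_mono D (show i + 1 ≤ j + 1 by omega)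
    have hD : ¬ D j := fun hD => by
      have := starts_succ_of (runStart_succ.2 hD)
      omega
    have hlt := (hf j hj).2 hD
    rcases Nat.lt_succ_iff_lt_or_eq.1 hij with h' | rfl
    · have h2 := starts_succ_of_not (mt runStart_succ.1 hD)
      exact (ih (by omega) (by omega) h').trans hlt
    · exact hlt

/-- A value attained as many times as there are runs is attained in every run. -/
theorem FollowsPattern.exists_same_run {f : Fin n → ℕ} (hf : FollowsPattern D f) {m : ℕ}
    (hm : Nat.card {v // f v = m} = starts D n) (i : Fin n) :
    ∃ j : Fin n, f j = m ∧ starts D (j + 1) = starts D (i + 1) := by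
  classical
  let A : Finset (Fin n) := Finset.univ.filter fun v => f v = m
  have hA : A.card = starts D n := by
    rw [← hm, Nat.card_eq_fintype_card, Fintype.card_subtype]
  have hpos : ∀ v : Fin n, starts D (v + 1) ∈ Finset.Icc 1 (starts D n) := fun v => by
    have h1 := starts_mono D (show 1 ≤ (v : ℕ) + 1 by omega)
    have h2 := starts_mono D (show (v : ℕ) + 1 ≤ n by omega)
    rw [starts_one] at h1
    exact Finset.mem_Icc.2 ⟨h1, h2⟩
  have hinj : Set.InjOn (fun v : Fin n => starts D (v + 1)) A := by
    intro u hu v hv huv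
    have hu' : f u = m := by simpa [A] using hu
    have hv' : f v = m := by simpa [A] using hv
    rcases lt_trichotomy u v with h | h | h
    · have := hf.lt_of_same_run h huv
      omega
    · exact h
    · have := hf.lt_of_same_run h huv.symm
      omega
  have himg : A.image (fun v : Fin n => starts D (v + 1)) = Finset.Icc 1 (starts D n) := by
    apply Finset.eq_of_subset_of_card_le
    · exact Finset.image_subset_iff.2 fun v _ => hpos v
    · rw [Finset.card_image_of_injOn hinj, hA]
      simp
  have := hpos i
  rw [← himg] at this
  obtain ⟨j, hj, hj'⟩ := Finset.mem_image.1 this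
  exact ⟨j, by simpa [A] using hj, hj'⟩

theorem FollowsPattern.le_of_runStart {f : Fin n → ℕ} (hf : FollowsPattern D f) {m : ℕ}
    (hm : Nat.card {v // f v = m} = starts D n) (i : Fin n) (hi : RunStart D i) : f i ≤ m := by
  obtain ⟨j, rfl, hj⟩ := hf.exists_same_run hm i
  rcases lt_trichotomy i j with h | h | h
  · exact (hf.lt_of_same_run h hj.symm).le
  · rw [h]
  · have h1 := starts_mono D (show (j : ℕ) + 1 ≤ i from h)
    have := starts_succ_of hi
    omega

theorem FollowsPattern.eq_of_le {f : Fin n → ℕ} (hf : FollowsPattern D f) {m : ℕ}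
    (hm : Nat.card {v // f v = m} = starts D n) (i : Fin n) (hi : f i ≤ m)
    (hnext : ∀ h : (i : ℕ) + 1 < n, ¬ D i → m < f ⟨i + 1, h⟩) : f i = m := by
  obtain ⟨j, rfl, hj⟩ := hf.exists_same_run hm i
  rcases lt_trichotomy i j with h | h | h
  · exfalso
    have hlt : (i : ℕ) + 1 < n := by have : (i : ℕ) < j := h; omega
    have h1 := starts_mono D (show (i : ℕ) + 1 + 1 ≤ j + 1 by have : (i : ℕ) < j := h; omega)
    have hD : ¬ D i := fun hD => by
      have := starts_succ_of (runStart_succ.2 hD)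
      omega
    have h2 := hnext hlt hD
    have h3 := starts_succ_of_not (mt runStart_succ.1 hD)
    rcases lt_or_eq_of_le (show (⟨i + 1, hlt⟩ : Fin n) ≤ j from h) with h' | h'
    · have := hf.lt_of_same_run h' (by simp only; omega)
      omega
    · rw [h'] at h2
      omega
  · rw [h]
  · exact le_antisymm hi (hf.lt_of_same_run h hj).le

theorem usesPalette_of_injOn_nonstarts {g : Fin n → ℕ} (hst : ∀ i : Fin n, RunStart D i → g i = 1)
    (hns : ∀ i : Fin n, ¬ RunStart D i → 2 ≤ g i ∧ g i ≤ nonstarts D n + 1)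
    (hinj : ∀ i j : Fin n, ¬ RunStart D i → ¬ RunStart D j → g i = g j → i = j) :
    usesPalette (spikeList (nonstarts D n) (starts D n) 0) g := by
  classical
  have hcount : (Finset.univ.filter fun v : Fin n => RunStart D v).card = starts D n := by
    rw [starts, Nat.count_eq_card_filter_range, ← Finset.card_map Fin.valEmbedding]
    congr 1
    ext x
    simp only [Finset.mem_map, Finset.mem_filter, Finset.mem_univ, true_and, Finset.mem_range,
      Fin.valEmbedding_apply]
    constructor
    · rintro ⟨v, hv, rfl⟩
      exact ⟨v.2, hv⟩
    · rintro ⟨hx, hv⟩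
      exact ⟨⟨x, hx⟩, hv, rfl⟩
  rw [usesPalette_spikeList]
  refine ⟨fun v => ?_, fun i => ?_⟩
  · by_cases h : RunStart D v
    · rw [hst v h]
      omega
    · have := hns v h
      omega
  · rw [Nat.card_eq_fintype_card, Fintype.card_subtype]
    by_cases hi : i = 0
    · subst hi
      rw [if_pos rfl, ← hcount]
      congr 1
      ext v
      simp only [Finset.mem_filter, Finset.mem_univ, true_and, Fin.val_zero, zero_add]
      refine ⟨fun h => ?_, hst v⟩
      by_contra hv
      have := hns v hv
      omega
    · rw [if_neg hi]
      have hi0 : (i : ℕ) ≠ 0 := fun h => hi (Fin.ext h)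
      let N : Finset (Fin n) := Finset.univ.filter fun v : Fin n => ¬ RunStart D v
      have hN : N.card = nonstarts D n := by
        have h1 := Finset.card_filter_add_card_filter_not (s := (Finset.univ : Finset (Fin n)))
          (fun v : Fin n => RunStart D v)
        have h2 := starts_add_nonstarts D n
        rw [hcount, Finset.card_univ, Fintype.card_fin] at h1
        simp only [N]
        omega
      have hg : Set.InjOn g N := fun u hu v hv huv =>
        hinj u v (by simpa [N] using hu) (by simpa [N] using hv) huv
      have himg : N.image g = Finset.Icc 2 (nonstarts D n + 1) := by
        apply Finset.eq_of_subset_of_card_le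
        · exact Finset.image_subset_iff.2 fun v hv =>
            Finset.mem_Icc.2 (hns v (by simpa [N] using hv))
        · rw [Finset.card_image_of_injOn hg, hN]
          simp
      have hmem : (i : ℕ) + 1 ∈ N.image g := by
        rw [himg, Finset.mem_Icc]
        omega
      obtain ⟨v, hv, hvi⟩ := Finset.mem_image.1 hmem
      rw [Finset.card_eq_one]
      refine ⟨v, ?_⟩
      ext u
      simp only [Finset.mem_filter, Finset.mem_univ, true_and, Finset.mem_singleton]
      refine ⟨fun hu => ?_, fun hu => hu ▸ hvi⟩
      refine hinj u v (fun hst' => ?_) (by simpa [N] using hv) (hu.trans hvi.symm)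
      have := hst u hst'
      omega

open Classical in
/-- Within every run, move the value `m` to the front, renaming it `1` and raising by one the
values below `m`. -/
noncomputable def moveToFront (D : ℕ → Prop) (m : ℕ) (f : Fin n → ℕ) (i : Fin n) : ℕ :=
  if m < f i then f i
  else if RunStart D i then 1
  else f ⟨i - 1, by omega⟩ + 1

theorem FollowsPattern.pred_lt {f : Fin n → ℕ} (hf : FollowsPattern D f) (i : Fin n)
    (hi : ¬ RunStart D i) : f ⟨i - 1, by omega⟩ < f i := by
  obtain ⟨i, h⟩ := i
  cases i with
  | zero => exact absurd (Or.inl rfl) hi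
  | succ i => exact (hf i h).2 (mt runStart_succ.2 hi)

theorem FollowsPattern.moveToFront_le {f : Fin n → ℕ} (hf : FollowsPattern D f)
    (hpos : ∀ v, 1 ≤ f v) (m : ℕ) (i : Fin n) : moveToFront D m f i ≤ f i := by
  unfold moveToFront
  split_ifs with h1 h2
  · exact le_rfl
  · exact hpos i
  · exact hf.pred_lt i h2

theorem FollowsPattern.moveToFront {f : Fin n → ℕ} (hf : FollowsPattern D f)
    (hD : ∀ i, D i → ¬ RunStart D i) (hpos : ∀ v, 1 ≤ f v) {m : ℕ} (hm1 : 1 ≤ m)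
    (hm : Nat.card {v // f v = m} = starts D n) :
    FollowsPattern D (moveToFront D m f) := by
  intro i h
  have hle := hf.moveToFront_le hpos m ⟨i, by omega⟩
  constructor
  · intro hi
    have hst : RunStart D (i + 1) := runStart_succ.2 hi
    have h1 := hf.le_of_runStart hm ⟨i + 1, h⟩ hst
    have h2 := hpos ⟨i - 1, by omega⟩
    simp only [_root_.moveToFront, not_lt.2 h1, hst, hD i hi, if_true, if_false]
    split_ifs <;> omega
  · intro hi
    have hst : ¬ RunStart D (i + 1) := mt runStart_succ.1 hi
    have h1 := (hf i h).2 hi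
    refine lt_of_le_of_lt hle ?_
    simp only [_root_.moveToFront, hst, if_false, Nat.add_sub_cancel]
    split_ifs <;> omega

theorem FollowsPattern.usesPalette_moveToFront {f : Fin n → ℕ} (hf : FollowsPattern D f)
    {m : Fin (nonstarts D n + 1)}
    (hp : usesPalette (spikeList (nonstarts D n) (starts D n) m) f) (hm0 : 1 ≤ (m : ℕ)) :
    usesPalette (spikeList (nonstarts D n) (starts D n) 0) (_root_.moveToFront D (m + 1) f) := by
  rw [usesPalette_spikeList] at hp
  obtain ⟨hb, hc⟩ := hp
  have hm := hc m
  rw [if_pos rfl] at hm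
  have huniq : ∀ u v : Fin n, f u = f v → f u ≠ m + 1 → u = v := by
    intro u v huv hu
    have hbu := hb u
    have h1 := hc ⟨f u - 1, by omega⟩
    rw [if_neg (fun h => hu (by rw [← h]; simp only; omega))] at h1
    have h1 : Nat.card {v // f v = f u} = 1 := by
      rw [← h1]
      congr! 3
      simp only
      omega
    have := (Nat.card_eq_one_iff_unique.1 h1).1
    exact congrArg Subtype.val (Subsingleton.elim (⟨u, rfl⟩ : {v // f v = f u}) ⟨v, huv.symm⟩)
  have hle := hf.moveToFront_le (fun v => (hb v).1) (m + 1)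
  apply usesPalette_of_injOn_nonstarts
  · intro i hi
    have := hf.le_of_runStart hm i hi
    simp [_root_.moveToFront, not_lt.2 this, hi]
  · intro i hi
    refine ⟨?_, (hle i).trans (hb i).2⟩
    have := (hb ⟨i - 1, by omega⟩).1
    simp only [_root_.moveToFront, hi, if_false]
    split_ifs <;> omega
  · intro i j hi hj hij
    have hi' := hf.pred_lt i hi
    have hj' := hf.pred_lt j hj
    simp only [_root_.moveToFront, hi, hj, if_false] at hij
    split_ifs at hij with h1 h2 h2
    · exact huniq i j hij (by omega)
    · omega
    · omega
    · have := huniq ⟨i - 1, by omega⟩ ⟨j - 1, by omega⟩ (by omega) (by omega)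
      have h3 : (i : ℕ) ≠ 0 := fun h => hi (Or.inl h)
      have h4 : (j : ℕ) ≠ 0 := fun h => hj (Or.inl h)
      simp only [Fin.mk.injEq] at this
      exact Fin.ext (by omega)

theorem FollowsPattern.lt_moveToFront_iff {f : Fin n → ℕ} (hf : FollowsPattern D f)
    (hpos : ∀ v, 1 ≤ f v) (m : ℕ) (i : Fin n) : m < _root_.moveToFront D m f i ↔ m < f i := by
  refine ⟨fun h => h.trans_le (hf.moveToFront_le hpos m i), fun h => ?_⟩
  simp [_root_.moveToFront, h]

theorem moveToFront_injOn {f g : Fin n → ℕ} (hf : FollowsPattern D f) (hg : FollowsPattern D g)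
    (hfpos : ∀ v, 1 ≤ f v) (hgpos : ∀ v, 1 ≤ g v) {m : ℕ}
    (hfm : Nat.card {v // f v = m} = starts D n) (hgm : Nat.card {v // g v = m} = starts D n)
    (h : moveToFront D m f = moveToFront D m g) : f = g := by
  have hiff : ∀ i, m < f i ↔ m < g i := fun i => by
    rw [← hf.lt_moveToFront_iff hfpos, h, hg.lt_moveToFront_iff hgpos]
  funext i
  by_cases hi : m < f i
  · have := congrFun h i
    simpa [moveToFront, hi, (hiff i).1 hi] using this
  · have hi' := mt (hiff i).2 hi
    by_cases hnext : ∀ h : (i : ℕ) + 1 < n, ¬ D i → m < f ⟨i + 1, h⟩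
    · rw [hf.eq_of_le hfm i (not_lt.1 hi) hnext,
        hg.eq_of_le hgm i (not_lt.1 hi') fun h hD => (hiff _).1 (hnext h hD)]
    · push Not at hnext
      obtain ⟨hlt, hD, hle⟩ := hnext
      have hle' := mt (hiff _).2 (not_lt.2 hle)
      have hst : ¬ RunStart D (i + 1) := mt runStart_succ.1 hD
      have := congrFun h ⟨i + 1, hlt⟩
      simpa [moveToFront, not_lt.2 hle, hle', hst] using this

open Classical in
/-- The filling with value `1` at the run starts and distinct values, increasing from left to
right, at the other positions. -/
noncomputable def standardFilling (n : ℕ) (D : ℕ → Prop) (i : Fin n) : ℕ :=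
  if RunStart D i then 1 else nonstarts D i + 2

theorem nonstarts_succ_of_not {i : ℕ} (h : ¬ RunStart D i) :
    nonstarts D (i + 1) = nonstarts D i + 1 := by
  classical
  simp [nonstarts, Nat.count_succ, h]

theorem nonstarts_succ_of {i : ℕ} (h : RunStart D i) :
    nonstarts D (i + 1) = nonstarts D i := by
  classical
  simp [nonstarts, Nat.count_succ, h]

theorem nonstarts_mono (D : ℕ → Prop) : Monotone (nonstarts D) := by
  classical
  exact Nat.count_monotone _

theorem followsPattern_standardFilling (hD : ∀ i, D i → ¬ RunStart D i) :
    FollowsPattern D (standardFilling n D) := by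
  intro i h
  constructor
  · intro hi
    simp [standardFilling, runStart_succ.2 hi, hD i hi]
  · intro hi
    simp only [standardFilling, mt runStart_succ.1 hi, if_false]
    split_ifs with h1
    · omega
    · rw [nonstarts_succ_of_not h1]
      omega

theorem usesPalette_standardFilling :
    usesPalette (spikeList (nonstarts D n) (starts D n) 0) (standardFilling n D) := by
  classical
  apply usesPalette_of_injOn_nonstarts
  · intro i hi
    simp [standardFilling, hi]
  · intro i hi
    have h1 := nonstarts_mono D (show (i : ℕ) + 1 ≤ n from i.2)
    rw [nonstarts_succ_of_not hi] at h1
    simp only [standardFilling, hi, if_false]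
    omega
  · intro i j hi hj hij
    simp only [standardFilling, hi, hj, if_false, Nat.add_right_cancel_iff] at hij
    exact Fin.ext (Nat.count_injective (p := fun j => ¬ RunStart D j) hi hj hij)

theorem nonstarts_succ_eq {d : ℕ} (hd : ∀ i < d, ¬ D i) (j : ℕ) (hj : j ≤ d) :
    nonstarts D (j + 1) = j := by
  induction j with
  | zero => rw [nonstarts_succ_of (Or.inl rfl)]; simp [nonstarts]
  | succ j ih =>
    rw [nonstarts_succ_of_not (mt runStart_succ.1 (hd j (by omega))), ih (by omega)]

/-- If `d` is the first descent, the standard filling is not in the image of `moveToFront`. -/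
theorem moveToFront_ne_standardFilling {f : Fin n → ℕ} (hf : FollowsPattern D f)
    (hpos : ∀ v, 1 ≤ f v) {d : ℕ} (hdn : d + 2 < n) (hd : D d) (hfirst : ∀ i < d, ¬ D i)
    (hd1 : 1 ≤ d) (hnext : ¬ D (d + 1)) (hm : Nat.card {v // f v = d + 1} = starts D n) :
    moveToFront D (d + 1) f ≠ standardFilling n D := by
  intro h
  have hiff : ∀ i, d + 1 < f i ↔ d + 1 < standardFilling n D i := fun i => by
    rw [← h, hf.lt_moveToFront_iff hpos]
  have hdst : ¬ RunStart D d := by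
    obtain ⟨e, rfl⟩ : ∃ e, d = e + 1 := ⟨d - 1, by omega⟩
    exact mt runStart_succ.1 (hfirst e (by omega))
  have hsucc := runStart_succ.2 hd
  have hsucc2 : ¬ RunStart D (d + 2) := mt runStart_succ.1 hnext
  have hns : nonstarts D (d + 1) = d := nonstarts_succ_eq hfirst d le_rfl
  have h0 : f ⟨d, by omega⟩ = d + 1 := by
    refine hf.eq_of_le hm _ (not_lt.1 (mt (hiff _).1 ?_)) fun _ h => absurd hd h
    have := nonstarts_succ_of_not hdst
    simp only [standardFilling, hdst, if_false]
    omega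
  have h1 : f ⟨d + 1, by omega⟩ = d + 1 := by
    refine hf.eq_of_le hm _ (not_lt.1 (mt (hiff _).1 ?_)) fun _ _ => (hiff _).2 ?_
    · simp only [standardFilling, hsucc, if_true]
      omega
    · have := nonstarts_succ_of hsucc
      simp only [standardFilling, show d + 1 + 1 = d + 2 from rfl, hsucc2, if_false] at this ⊢
      omega
  have := (hf d (by omega)).1 hd
  omega

/-- For a pattern whose descents are isolated and interior, the number of fillings depends on the
order of the multiplicities. -/
theorem card_followsPattern_ne {d : ℕ} (hdn : d + 2 < n) (hd : D d) (hfirst : ∀ i < d, ¬ D i)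
    (hD : ∀ i, D i → ¬ RunStart D i) (hnext : ¬ D (d + 1))
    (m : Fin (nonstarts D n + 1)) (hmd : (m : ℕ) = d) :
    Nat.card {f : Fin n → ℕ // FollowsPattern D f ∧
      usesPalette (spikeList (nonstarts D n) (starts D n) m) f} ≠
    Nat.card {f : Fin n → ℕ // FollowsPattern D f ∧
      usesPalette (spikeList (nonstarts D n) (starts D n) 0) f} := by
  have hd1 : 1 ≤ d := Nat.one_le_iff_ne_zero.2 fun h => hD d hd (Or.inl h)
  have hfin : ∀ m, Finite {f : Fin n → ℕ // FollowsPattern D f ∧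
      usesPalette (spikeList (nonstarts D n) (starts D n) m) f} := fun m => by
    refine ((Set.finite_Icc (fun _ : Fin n => 1)
      (fun _ => nonstarts D n + 1)).subset fun f hf => ?_).to_subtype
    have := (usesPalette_spikeList.1 hf.2).1
    exact ⟨fun v => (this v).1, fun v => (this v).2⟩
  have hpos : ∀ f : Fin n → ℕ, usesPalette (spikeList (nonstarts D n) (starts D n) m) f →
      ∀ v, 1 ≤ f v := fun f hf v => ((usesPalette_spikeList.1 hf).1 v).1
  have hcard : ∀ f : Fin n → ℕ, usesPalette (spikeList (nonstarts D n) (starts D n) m) f →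
      Nat.card {v // f v = (m : ℕ) + 1} = starts D n := fun f hf => by
    simpa using (usesPalette_spikeList.1 hf).2 m
  intro heq
  have := hfin m
  have := hfin 0
  let φ : {f : Fin n → ℕ // FollowsPattern D f ∧
      usesPalette (spikeList (nonstarts D n) (starts D n) m) f} →
    {f : Fin n → ℕ // FollowsPattern D f ∧
      usesPalette (spikeList (nonstarts D n) (starts D n) 0) f} := fun f =>
    ⟨moveToFront D (m + 1) f.1,
      f.2.1.moveToFront hD (hpos _ f.2.2) (by omega) (hcard _ f.2.2),
      f.2.1.usesPalette_moveToFront f.2.2 (by omega)⟩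
  have hinj : Function.Injective φ := fun f g h =>
    Subtype.ext (moveToFront_injOn f.2.1 g.2.1 (hpos _ f.2.2) (hpos _ g.2.2) (hcard _ f.2.2)
      (hcard _ g.2.2) (congrArg Subtype.val h))
  obtain ⟨f, hf⟩ := hinj.surjective_of_finite (Finite.card_eq.1 heq).some
    ⟨standardFilling n D, followsPattern_standardFilling hD, usesPalette_standardFilling⟩
  have hc := hcard _ f.2.2
  have hv := congrArg Subtype.val hf
  simp only [φ, hmd] at hv hc
  exact moveToFront_ne_standardFilling f.2.1 (hpos _ f.2.2) hdn hd hfirst hd1 hnext hc hv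

end Zigzag

section PathGraph

variable {n : ℕ}

/-- The descent positions of a permutation. -/
def descentAt (w : Equiv.Perm (Fin n)) (i : ℕ) : Prop :=
  ∃ h : i + 1 < n, w ⟨i + 1, h⟩ < w ⟨i, by omega⟩

theorem pathGraph_adj {w : Equiv.Perm (Fin n)} {u v : Fin n} :
    (pathGraph w).Adj u v ↔ ∃ i : ℕ, ∃ h : i + 1 < n,
      (u = w ⟨i, by omega⟩ ∧ v = w ⟨i + 1, h⟩) ∨ (v = w ⟨i, by omega⟩ ∧ u = w ⟨i + 1, h⟩) := by
  simp only [pathGraph, SimpleGraph.fromRel_adj]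
  constructor
  · rintro ⟨-, ⟨i, h, h'⟩ | ⟨i, h, h'⟩⟩
    · exact ⟨i, h, Or.inl h'⟩
    · exact ⟨i, h, Or.inr h'⟩
  · rintro ⟨i, h, ⟨rfl, rfl⟩ | ⟨rfl, rfl⟩⟩
    · exact ⟨by simp, Or.inl ⟨i, h, rfl, rfl⟩⟩
    · exact ⟨by simp, Or.inr ⟨i, h, rfl, rfl⟩⟩

theorem ascNum_pathGraph (w : Equiv.Perm (Fin n)) (c : Fin n → ℕ) :
    ascNum (pathGraph w) c = Nat.card {i : Fin (n - 1) //
      (descentAt w i → c (w ⟨i + 1, by omega⟩) < c (w ⟨i, by omega⟩)) ∧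
      (¬ descentAt w i → c (w ⟨i, by omega⟩) < c (w ⟨i + 1, by omega⟩))} := by
  classical
  symm
  let e : Fin (n - 1) → Fin n × Fin n := fun i =>
    if descentAt w i then (w ⟨i + 1, by omega⟩, w ⟨i, by omega⟩)
    else (w ⟨i, by omega⟩, w ⟨i + 1, by omega⟩)
  have he : ∀ i : Fin (n - 1), ((e i).1 < (e i).2 ∧ (pathGraph w).Adj (e i).1 (e i).2) ∧
      (c (e i).1 < c (e i).2 ↔
      (descentAt w i → c (w ⟨i + 1, by omega⟩) < c (w ⟨i, by omega⟩)) ∧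
      (¬ descentAt w i → c (w ⟨i, by omega⟩) < c (w ⟨i + 1, by omega⟩))) := by
    intro i
    by_cases hi : descentAt w i
    · simp only [e, hi, if_true]
      obtain ⟨h, hlt⟩ := hi
      exact ⟨⟨hlt, pathGraph_adj.2 ⟨i, h, Or.inr ⟨rfl, rfl⟩⟩⟩, by simp⟩
    · simp only [e, hi, if_false]
      have hlt : i + 1 < n := by omega
      refine ⟨⟨lt_of_le_of_ne (not_lt.1 fun h => hi ⟨hlt, h⟩) (by simp),
        pathGraph_adj.2 ⟨i, hlt, Or.inl ⟨rfl, rfl⟩⟩⟩, by simp⟩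
  refine Nat.card_congr (Equiv.ofBijective (fun i => ⟨e i.1, (he i.1).1.1, (he i.1).1.2,
    (he i.1).2.2 i.2⟩) ⟨?_, ?_⟩)
  · rintro ⟨i, hi⟩ ⟨j, hj⟩ h
    have h := congrArg Subtype.val h
    simp only [e] at h
    apply Subtype.ext
    apply Fin.ext
    split_ifs at h <;> simp at h <;> simp only <;> omega
  · rintro ⟨⟨u, v⟩, huv, hadj, hc⟩
    obtain ⟨i, h, h'⟩ := pathGraph_adj.1 hadj
    have hei : e ⟨i, by omega⟩ = (u, v) := by
      rcases h' with ⟨rfl, rfl⟩ | ⟨rfl, rfl⟩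
      · have : ¬ descentAt w i := fun ⟨_, h''⟩ => lt_asymm huv h''
        simp [e, this]
      · have : descentAt w i := ⟨h, huv⟩
        simp [e, this]
    refine ⟨⟨⟨i, by omega⟩, (he ⟨i, by omega⟩).2.1 (by rw [hei]; exact hc)⟩, Subtype.ext hei⟩

theorem proper_and_ascNum_eq_iff (w : Equiv.Perm (Fin n)) (c : Fin n → ℕ) :
    (properColoring (pathGraph w) c ∧ ascNum (pathGraph w) c = n - 1) ↔
      FollowsPattern (descentAt w) (c ∘ w) := by
  classical
  have hasc : ascNum (pathGraph w) c = n - 1 ↔ FollowsPattern (descentAt w) (c ∘ w) := by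
    rw [ascNum_pathGraph, Nat.card_eq_fintype_card, Fintype.card_subtype]
    conv_lhs => rhs; rw [← Fintype.card_fin (n - 1), ← Finset.card_univ]
    rw [Finset.card_filter_eq_iff]
    constructor
    · intro h i hi
      exact h ⟨i, by omega⟩ (Finset.mem_univ _)
    · intro h i _
      exact h i (by have := i.2; omega)
  rw [hasc, and_iff_right_iff_imp]
  intro h u v huv
  obtain ⟨i, hi, h'⟩ := pathGraph_adj.1 huv
  have h1 := h i hi
  simp only [Function.comp] at h1
  have hne : c (w ⟨i, by omega⟩) ≠ c (w ⟨i + 1, hi⟩) := by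
    by_cases hD : descentAt w i
    · exact (h1.1 hD).ne'
    · exact (h1.2 hD).ne
  rcases h' with ⟨rfl, rfl⟩ | ⟨rfl, rfl⟩
  · exact hne
  · exact hne.symm

theorem usesPalette_comp_perm (w : Equiv.Perm (Fin n)) (L : List ℕ) (c : Fin n → ℕ) :
    usesPalette L (c ∘ w) ↔ usesPalette L c := by
  refine and_congr ⟨fun h v => ?_, fun h v => h _⟩ (forall_congr' fun i => ?_)
  · simpa using h (w.symm v)
  · rw [Nat.card_congr (w.subtypeEquiv (p := fun v => (c ∘ w) v = (i : ℕ) + 1)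
      (q := fun v => c v = (i : ℕ) + 1) fun v => Iff.rfl)]

theorem NG_pathGraph_top (w : Equiv.Perm (Fin n)) (L : List ℕ) :
    NG (pathGraph w) L (n - 1) =
      Nat.card {f : Fin n → ℕ // FollowsPattern (descentAt w) f ∧ usesPalette L f} := by
  refine Nat.card_congr ((w.symm.arrowCongr (Equiv.refl ℕ)).subtypeEquiv fun c => ?_)
  have : (w.symm.arrowCongr (Equiv.refl ℕ)) c = c ∘ w := by
    funext v
    simp [Equiv.arrowCongr]
  rw [this, usesPalette_comp_perm, ← proper_and_ascNum_eq_iff]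
  tauto

theorem adPattern_getElem?_eq_false_iff (w : Equiv.Perm (Fin n)) (i : ℕ) :
    (adPattern w)[i]? = some false ↔ descentAt w i := by
  simp only [adPattern, List.getElem?_ofFn, descentAt]
  by_cases h : i < n - 1
  · have h' : i + 1 < n := by omega
    have hne : w ⟨i, by omega⟩ ≠ w ⟨i + 1, h'⟩ := by simp
    simp only [h, dif_pos, Option.some.injEq, decide_eq_false_iff_not, not_lt, h', exists_true_left]
    exact ⟨fun hle => lt_of_le_of_ne hle hne.symm, le_of_lt⟩
  · simp only [h, dif_neg, not_false_eq_true, reduceCtorEq, false_iff, not_exists]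
    intro h'
    omega

end PathGraph

/-- If the ribbon composition `(α₁,…,α_k)` of `w` has `k ≥ 2` parts,
all of size at least `2`, then the CQF of `P_w` is not symmetric. -/
theorem stmt6 (n : ℕ) (w : Equiv.Perm (Fin n)) (α : List ℕ)
    (hcomp : IsComposition n α) (hrib : adPattern w = ribbonWord α)
    (hlen : 2 ≤ α.length) (h2 : ∀ a ∈ α, 2 ≤ a) :
    ¬ cqfSymmetric (pathGraph w) := by
  classical
  have hiso : ∀ i, descentAt w i → 1 ≤ i ∧ ¬ descentAt w (i - 1) ∧ i + 2 < n ∧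
      ¬ descentAt w (i + 1) := by
    intro i hi
    rw [← adPattern_getElem?_eq_false_iff, hrib] at hi
    obtain ⟨h1, hp, hn⟩ := ribbonWord_isolated_descents α h2 i hi
    have hlt : i + 1 < (adPattern w).length := by
      rw [hrib]
      exact (List.getElem?_eq_some_iff.1 hn).1
    rw [adPattern, List.length_ofFn] at hlt
    rw [← adPattern_getElem?_eq_false_iff, ← adPattern_getElem?_eq_false_iff, hrib, hp, hn]
    exact ⟨h1, by simp, by omega, by simp⟩
  have hex : ∃ i, descentAt w i := by
    obtain ⟨i, hi, hi'⟩ := List.getElem_of_mem (false_mem_ribbonWord hlen)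
    exact ⟨i, by rw [← adPattern_getElem?_eq_false_iff, hrib, List.getElem?_eq_getElem hi, hi']⟩
  have hd := Nat.find_spec hex
  have hfirst : ∀ i < Nat.find hex, ¬ descentAt w i := fun i hi => Nat.find_min hex hi
  generalize Nat.find hex = d at hd hfirst
  obtain ⟨hd1, -, hdn, hnext⟩ := hiso d hd
  have hD : ∀ i, descentAt w i → ¬ RunStart (descentAt w) i := by
    rintro i hi (h | h)
    · have := (hiso i hi).1
      omega
    · exact (hiso i hi).2.1 h
  have hdl : d < nonstarts (descentAt w) n + 1 := by
    have h1 := nonstarts_succ_eq hfirst d le_rfl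
    have h2 := nonstarts_mono (descentAt w) (show d + 1 ≤ n by omega)
    omega
  have hk : 0 < starts (descentAt w) n := by
    have := starts_mono (descentAt w) (show 1 ≤ n by omega)
    rwa [starts_one] at this
  have hn := (starts_add_nonstarts (descentAt w) n).symm
  intro hsym
  have h := hsym _ _ (isComposition_spikeList hk hn ⟨d, hdl⟩) (isComposition_spikeList hk hn 0)
    (spikeList_perm _ _ _ _) (n - 1)
  rw [NG_pathGraph_top, NG_pathGraph_top] at h
  exact card_followsPattern_ne hdn hd hfirst hD hnext ⟨d, hdl⟩ rfl h
end
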